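/- Let b ≥ 3 and D ⊆ {0,...,b−1} with |D| = 2, and let C be the set of x ∈ [0,1] admitting a base-b expansion using only digits from D. Then for every function Ψ: ℕ → (0,1] there exists a Liouville number ξ ∈ C and a constant Q (depending only on b and D) such that every convergent p/q of ξ with q ≥ Q lies in C and satisfies |ξ − p/q| < min(Ψ(q), q^{-q}). -/

import Mathlib

open Filter Topology

theorem exists_int_continuants {ξ : ℝ} (hξ : Irrational ξ) :
    ∃ (A : ℕ → ℤ) (B : ℕ → ℕ), (∀ n, (GenContFract.of ξ).nums n = A n) ∧
      (∀ n, (GenContFract.of ξ).dens n = B n) ∧ (∀ n, 0 < B n) ∧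
      (∀ n, B n + B (n + 1) ≤ B (n + 2)) ∧
      (∀ n, A n * B (n + 1) - B n * A (n + 1) = (-1) ^ (n + 1)) := by
  set g := GenContFract.of ξ with hg
  have hterm : ∀ n, ¬ g.TerminatedAt n := by
    intro n hn
    obtain ⟨r, hr⟩ := (GenContFract.terminates_iff_rat ξ).1 ⟨n, hn⟩
    exact hξ ⟨r, hr.symm⟩
  have hcoeff : ∀ n, ∃ z : ℕ, 1 ≤ z ∧ g.s.get? n = some ⟨1, (z : ℝ)⟩ := by
    intro n
    obtain ⟨gp, hgp⟩ := Option.ne_none_iff_exists'.1 (hterm n)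
    obtain ⟨ha, z, hz⟩ := GenContFract.of_partNum_eq_one_and_exists_int_partDen_eq hgp
    have h1 : 1 ≤ gp.b := GenContFract.of_one_le_get?_partDen
      (GenContFract.partDen_eq_s_b hgp)
    have hz1 : 1 ≤ z := by rw [hz] at h1; exact_mod_cast h1
    lift z to ℕ using by lia
    refine ⟨z, by exact_mod_cast hz1, ?_⟩
    rw [hgp]
    cases gp
    simp_all
  choose z hz1 hz using hcoeff
  have hint : ∀ n, (∃ A A' : ℤ, ∃ B B' : ℕ, g.nums n = A ∧ g.nums (n + 1) = A' ∧
      g.dens n = B ∧ g.dens (n + 1) = B') := by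
    intro n
    induction n with
    | zero =>
      refine ⟨⌊ξ⌋, z 0 * ⌊ξ⌋ + 1, 1, z 0, ?_, ?_, ?_, ?_⟩
      · simp [hg]
      · rw [GenContFract.first_num_eq (hz 0)]
        simp [hg]
      · simp
      · rw [zero_add, GenContFract.first_den_eq (hz 0)]
    | succ n ih =>
      obtain ⟨A, A', B, B', hA, hA', hB, hB'⟩ := ih
      refine ⟨A', z (n + 1) * A' + 1 * A, B', z (n + 1) * B' + 1 * B, hA', ?_, hB', ?_⟩
      · rw [GenContFract.nums_recurrence (hz (n + 1)) hA hA']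
        push_cast; rfl
      · rw [GenContFract.dens_recurrence (hz (n + 1)) hB hB']
        push_cast; rfl
  have hA : ∀ n, ∃ A : ℤ, g.nums n = A := fun n => by
    obtain ⟨A, _, _, _, h, _⟩ := hint n
    exact ⟨A, h⟩
  have hB : ∀ n, ∃ B : ℕ, g.dens n = B := fun n => by
    obtain ⟨_, _, B, _, _, _, h, _⟩ := hint n
    exact ⟨B, h⟩
  choose A hA using hA
  choose B hB using hB
  refine ⟨A, B, hA, hB, ?_, ?_, ?_⟩
  · intro n
    have h := GenContFract.succ_nth_fib_le_of_nth_den (v := ξ) (n := n) (Or.inr (hterm _))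
    rw [← hg, hB] at h
    exact (Nat.fib_pos.2 n.succ_pos).trans_le (by exact_mod_cast h)
  · intro n
    have h := GenContFract.dens_recurrence (hz (n + 1)) (hB n) (hB (n + 1))
    rw [hB] at h
    dsimp only at h
    have h' : B (n + 2) = z (n + 1) * B (n + 1) + 1 * B n := by exact_mod_cast h
    have := Nat.mul_le_mul_right (B (n + 1)) (hz1 (n + 1))
    lia
  · intro n
    have h := SimpContFract.determinant (s := SimpContFract.of ξ) (n := n) (hterm n)
    change g.nums n * g.dens (n + 1) - g.dens n * g.nums (n + 1) = _ at h
    rw [hA, hB, hA, hB] at h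
    exact_mod_cast h

theorem inv_le_abs_sub_convs {ξ : ℝ} (hξ : Irrational ξ) (n : ℕ) :
    1 / ((GenContFract.of ξ).dens n *
      ((GenContFract.of ξ).dens n + (GenContFract.of ξ).dens (n + 1))) ≤
      |ξ - (GenContFract.of ξ).convs n| := by
  obtain ⟨A, B, hA, hB, hpos, hadd, hdet⟩ := exists_int_continuants hξ
  have hterm : ¬ (GenContFract.of ξ).TerminatedAt (n + 1) := by
    intro hn
    obtain ⟨r, hr⟩ := (GenContFract.terminates_iff_rat ξ).1 ⟨_, hn⟩
    exact hξ ⟨r, hr.symm⟩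
  have h1 := GenContFract.abs_sub_convs_le hterm
  rw [GenContFract.conv_eq_num_div_den, hA, hB, hB] at h1
  rw [GenContFract.conv_eq_num_div_den, hA, hB, hB]
  have p0 : (0 : ℝ) < B n := by exact_mod_cast hpos n
  have p1 : (0 : ℝ) < B (n + 1) := by exact_mod_cast hpos (n + 1)
  have p2 : (0 : ℝ) < B (n + 2) := by exact_mod_cast hpos (n + 2)
  have hadd' : (B n : ℝ) + B (n + 1) ≤ B (n + 2) := by exact_mod_cast hadd n
  have hdet' : (A n * B (n + 1) - B n * A (n + 1) : ℝ) = (-1) ^ (n + 1) := by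
    exact_mod_cast hdet n
  have h2 : |(A n / B n : ℝ) - A (n + 1) / B (n + 1)| = 1 / (B n * B (n + 1)) := by
    rw [div_sub_div _ _ p0.ne' p1.ne', hdet', abs_div, abs_pow, abs_neg, abs_one, one_pow,
      abs_of_pos (mul_pos p0 p1)]
  have h3 : |(A n / B n : ℝ) - A (n + 1) / B (n + 1)| ≤
      |ξ - A n / B n| + |ξ - A (n + 1) / B (n + 1)| := by
    rw [abs_sub_comm ξ (A n / B n)]
    exact abs_sub_le _ _ _
  have h4 : (1 : ℝ) / (B (n + 1) * B (n + 2)) ≤ 1 / (B (n + 1) * (B n + B (n + 1))) := by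
    gcongr
  have h5 : (1 : ℝ) / (B n * B (n + 1)) - 1 / (B (n + 1) * (B n + B (n + 1))) =
      1 / (B n * (B n + B (n + 1))) := by
    field_simp
    ring
  have h6 : n + 1 + 1 = n + 2 := rfl
  rw [h6] at h1
  linarith

theorem natCast_eq_of_div_eq_div {a p : ℤ} {m q : ℕ} (hm : 0 < m) (hq : 0 < q)
    (ham : IsCoprime a m) (hpq : IsCoprime p q) (h : (a / m : ℝ) = p / q) : m = q := by
  rw [div_eq_div_iff (by positivity) (by positivity)] at h
  have h' : a * q = p * m := by exact_mod_cast h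
  have h1 : (m : ℤ) ∣ q := ham.symm.dvd_of_dvd_mul_left ⟨p, by linarith⟩
  have h2 : (q : ℤ) ∣ m := hpq.symm.dvd_of_dvd_mul_left ⟨a, by linarith⟩
  exact Nat.dvd_antisymm (by exact_mod_cast h1) (by exact_mod_cast h2)

theorem exists_convs_eq_of_abs_sub_lt {ξ : ℝ} (hξ : Irrational ξ) {p : ℤ} {q : ℕ} (hq : 0 < q)
    (hpq : IsCoprime p q) (h : |ξ - p / q| < 1 / (2 * (q : ℝ) ^ 2)) :
    ∃ i, (GenContFract.of ξ).convs i = p / q ∧ (GenContFract.of ξ).dens i = q := by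
  have hden : ((p / q : ℚ)).den = q := by
    have := Rat.den_div_eq_of_coprime (a := p) (b := q) (by exact_mod_cast hq)
      (by simpa using Int.isCoprime_iff_nat_coprime.1 hpq)
    exact_mod_cast this
  obtain ⟨i, hi⟩ := Real.exists_convs_eq_rat (ξ := ξ) (q := (p / q : ℚ))
    (by rw [hden]; push_cast; exact h)
  push_cast at hi
  refine ⟨i, hi, ?_⟩
  obtain ⟨A, B, hA, hB, hpos, -, hdet⟩ := exists_int_continuants hξ
  rw [GenContFract.conv_eq_num_div_den, hA, hB] at hi
  rw [hB, natCast_eq_of_div_eq_div (hpos i) hq ?_ hpq hi]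
  refine ⟨(-1) ^ (i + 1) * B (i + 1), -(-1) ^ (i + 1) * A (i + 1), ?_⟩
  have h1 : ((-1 : ℤ) ^ (i + 1)) * (-1) ^ (i + 1) = 1 := by
    rw [← mul_pow]; simp
  linear_combination (-1) ^ (i + 1) * hdet i + h1

theorem exists_convs_eq_of_det {ξ : ℝ} (hξ : Irrational ξ) {p : ℕ → ℤ} {q : ℕ → ℕ} {s : ℕ → ℤ}
    (hs : ∀ k, s k * s k = 1) (hq0 : 0 < q 0) (hq : ∀ k, 2 * q k ≤ q (k + 1))
    (hdet : ∀ k, p (k + 1) * q k - p k * q (k + 1) = s k)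
    (h : ∀ k, |ξ - p k / q k| < 1 / (q k * q (k + 1) : ℝ)) :
    ∃ i, ∀ k, (GenContFract.of ξ).convs (i + k) = p k / q k ∧
      (GenContFract.of ξ).dens (i + k) = q k := by
  have hpos : ∀ k, 0 < q k := fun k => by
    induction k with
    | zero => exact hq0
    | succ k ih => have := hq k; lia
  have hcop : ∀ k, IsCoprime (p k) (q k) := fun k =>
    ⟨-s k * q (k + 1), s k * p (k + 1), by linear_combination s k * hdet k + hs k⟩
  have hconv : ∀ k, ∃ i, (GenContFract.of ξ).convs i = p k / q k ∧
      (GenContFract.of ξ).dens i = q k := fun k => by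
    refine exists_convs_eq_of_abs_sub_lt hξ (hpos k) (hcop k) ((h k).trans_le ?_)
    have h1 : (0 : ℝ) < q k := by exact_mod_cast hpos k
    have h2 : (2 * q k : ℝ) ≤ q (k + 1) := by exact_mod_cast hq k
    apply one_div_le_one_div_of_le (by positivity)
    nlinarith
  obtain ⟨A, B, hA, hB, hBpos, hadd, -⟩ := exists_int_continuants hξ
  have hmono : Monotone B := monotone_nat_of_le_succ fun n => by
    have := GenContFract.of_den_mono (v := ξ) (n := n)
    rw [hB, hB] at this
    exact_mod_cast this
  obtain ⟨i, hi⟩ := hconv 0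
  refine ⟨i, fun k => ?_⟩
  induction k with
  | zero => exact hi
  | succ k ih =>
    obtain ⟨j, hj, hj'⟩ := hconv (k + 1)
    have hBi : B (i + k) = q k := by
      have := ih.2; rw [hB] at this; exact_mod_cast this
    have hBj : B j = q (k + 1) := by
      have := hj'; rw [hB] at this; exact_mod_cast this
    have h1 : q (k + 1) < B (i + k) + B (i + k + 1) := by
      have h2 := (inv_le_abs_sub_convs hξ (i + k)).trans_lt (ih.1 ▸ h k)
      rw [hB, hB, ← hBi] at h2
      have p0 : (0 : ℝ) < B (i + k) := by exact_mod_cast hBpos _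
      have p1 : (0 : ℝ) < B (i + k + 1) := by exact_mod_cast hBpos _
      have p2 : (0 : ℝ) < q (k + 1) := by exact_mod_cast hpos _
      rw [one_div_lt_one_div (by positivity) (by positivity), mul_lt_mul_iff_right₀ p0] at h2
      exact_mod_cast h2
    have h2 : j < i + k + 2 := by
      by_contra! hlt
      have := hmono hlt
      have := hadd (i + k)
      lia
    have h3 : i + k < j := by
      by_contra! hlt
      have := hmono hlt
      have := hq k
      have := hpos k
      lia
    obtain rfl : j = i + (k + 1) := by lia
    exact ⟨hj, hj'⟩

theorem exists_tendsto_of_alternating_det {p : ℕ → ℤ} {q : ℕ → ℕ} {s : ℕ → ℤ}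
    (hs : ∀ k, s k * s k = 1) (hs' : ∀ k, s (k + 1) = -s k) (hq0 : 0 < q 0)
    (hq : ∀ k, 2 * q k ≤ q (k + 1))
    (hdet : ∀ k, p (k + 1) * q k - p k * q (k + 1) = s k) :
    ∃ ξ : ℝ, Tendsto (fun k => (p k / q k : ℝ)) atTop (𝓝 ξ) ∧
      ∀ k, ξ ≠ p k / q k ∧ |ξ - p k / q k| < 1 / (q k * q (k + 1) : ℝ) := by
  have hgrow : ∀ k, 2 ^ k ≤ q k := fun k => by
    induction k with
    | zero => exact hq0
    | succ k ih => have := hq k; rw [pow_succ]; lia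
  have hpos : ∀ k, (0 : ℝ) < q k := fun k => by
    exact_mod_cast (Nat.two_pow_pos k).trans_le (hgrow k)
  have hsR : ∀ k, (s k : ℝ) * s k = 1 := fun k => by exact_mod_cast hs k
  have hsR' : ∀ k, (s (k + 1) : ℝ) = -s k := fun k => by exact_mod_cast hs' k
  have hqR : ∀ k, (2 * q k : ℝ) ≤ q (k + 1) := fun k => by exact_mod_cast hq k
  set r : ℕ → ℝ := fun k => (p k / q k : ℝ) with hr
  have hdiff : ∀ k, r (k + 1) - r k = s k / (q k * q (k + 1) : ℝ) := fun k => by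
    have h : (p (k + 1) * q k - p k * q (k + 1) : ℝ) = s k := by exact_mod_cast hdet k
    simp only [hr]
    rw [div_sub_div _ _ (hpos _).ne' (hpos _).ne', ← h]
    congr 1 <;> ring
  have habs : ∀ k, |(s k : ℝ)| = 1 := fun k => by
    rw [← sq_eq_sq₀ (abs_nonneg _) zero_le_one, sq_abs, sq, hsR, one_pow]
  have hcauchy : CauchySeq r := by
    refine cauchySeq_of_le_geometric (1 / 2) 1 (by norm_num) fun k => ?_
    rw [dist_comm, Real.dist_eq, hdiff, abs_div, habs, abs_of_pos (mul_pos (hpos _) (hpos _)),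
      one_mul, one_div_pow]
    apply one_div_le_one_div_of_le (by positivity)
    have h1 : (2 : ℝ) ^ k ≤ q k := by exact_mod_cast hgrow k
    have h2 : (1 : ℝ) ≤ q (k + 1) := by
      exact_mod_cast (Nat.one_le_two_pow).trans (hgrow (k + 1))
    nlinarith [hpos k]
  obtain ⟨ξ, hξ⟩ := cauchySeq_tendsto_of_complete hcauchy
  have hstep : ∀ k, 0 < s k * (r (k + 2) - r k) := fun k => by
    have h1 : (1 : ℝ) / (q (k + 1) * q (k + 2)) < 1 / (q k * q (k + 1)) := by
      rw [one_div_lt_one_div (mul_pos (hpos _) (hpos _)) (mul_pos (hpos _) (hpos _))]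
      nlinarith [hpos k, hpos (k + 1), hqR k, hqR (k + 1)]
    have h2 : (s k : ℝ) * (r (k + 2) - r k) =
        1 / (q k * q (k + 1)) - 1 / (q (k + 1) * q (k + 2)) := by
      have : r (k + 2) - r k = s k / (q k * q (k + 1)) - s k / (q (k + 1) * q (k + 2)) := by
        rw [← sub_add_sub_cancel (r (k + 2)) (r (k + 1)) (r k), hdiff k, hdiff (k + 1), hsR']
        ring
      rw [this, mul_sub, mul_div_assoc', mul_div_assoc', hsR]
    linarith
  have hside : ∀ k, 0 < s k * (ξ - r k) := fun k => by
    have hmono : StrictMono fun j => s k * r (k + 2 * j) := strictMono_nat_of_lt_succ fun j => by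
      have h1 : s (k + 2 * j) = s k := by
        induction j with
        | zero => rfl
        | succ j ih => rw [← ih, show k + 2 * (j + 1) = k + 2 * j + 1 + 1 by ring, hs', hs', neg_neg]
      have h2 := hstep (k + 2 * j)
      rw [h1, mul_sub] at h2
      rw [show k + 2 * (j + 1) = k + 2 * j + 2 by ring]
      linarith
    have htend : Tendsto (fun j => s k * r (k + 2 * j)) atTop (𝓝 (s k * ξ)) :=
      (hξ.comp (tendsto_atTop_mono (fun j => by dsimp only [id]; lia) tendsto_id)).const_mul _
    have h1 := hmono.monotone.ge_of_tendsto htend 1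
    have h2 := hmono zero_lt_one
    simp only [mul_zero, add_zero, mul_one] at h1 h2
    rw [mul_sub]
    linarith
  refine ⟨ξ, hξ, fun k => ⟨fun h => ?_, ?_⟩⟩
  · have := hside k
    rw [h] at this
    simp [hr] at this
  · have h1 := hside k
    have h2 := hside (k + 1)
    have h3 : |ξ - r k| = s k * (ξ - r k) := by
      rw [← abs_of_pos h1, abs_mul, habs, one_mul]
    have h4 : (s k : ℝ) * (r (k + 1) - r k) = 1 / (q k * q (k + 1)) := by
      rw [hdiff, mul_div_assoc', hsR]
    change |ξ - r k| < _
    rw [hsR'] at h2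
    rw [h3, ← h4]
    linarith

theorem hasSum_toggle_digits {b L M : ℕ} (hb : 2 ≤ b) (hL : 0 < L) {c : ℕ → ℕ} {e f : ℕ} {x : ℝ}
    (hc : ∀ t, c (M + (t + 1) * L - 1) = e)
    (hx : HasSum (fun j => (c j : ℝ) / (b : ℝ) ^ (j + 1)) x) {c' : ℕ → ℕ}
    (hc' : ∀ t, c' (M + (t + 1) * L - 1) = f)
    (hcc' : ∀ j, (∀ t, j ≠ M + (t + 1) * L - 1) → c' j = c j) :
    HasSum (fun j => (c' j : ℝ) / (b : ℝ) ^ (j + 1))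
      (x + ((f : ℝ) - e) / ((b : ℝ) ^ M * ((b : ℝ) ^ L - 1))) := by
  have hb0 : (0 : ℝ) < b := by positivity
  have hbL : (1 : ℝ) < (b : ℝ) ^ L := one_lt_pow₀ (by exact_mod_cast hb) hL.ne'
  have hLt : ∀ t, 1 ≤ (t + 1) * L := fun t => Nat.mul_pos t.succ_pos hL
  set g : ℕ → ℕ := fun t => M + (t + 1) * L - 1 with hg
  have hginj : Function.Injective g := fun t u h => by
    have h1 := hLt t
    have h2 := hLt u
    simp only [hg] at h
    have h3 : (t + 1) * L = (u + 1) * L := by lia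
    exact Nat.succ_injective (Nat.eq_of_mul_eq_mul_right hL h3)
  have hgeom : HasSum (fun t : ℕ => ((f : ℝ) - e) / (b : ℝ) ^ (g t + 1))
      (((f : ℝ) - e) / ((b : ℝ) ^ M * ((b : ℝ) ^ L - 1))) := by
    have h := (hasSum_geometric_of_lt_one (r := ((b : ℝ) ^ L)⁻¹) (by positivity)
      (inv_lt_one_of_one_lt₀ hbL)).mul_left (((f : ℝ) - e) / ((b : ℝ) ^ M * (b : ℝ) ^ L))
    have hval : ((f : ℝ) - e) / ((b : ℝ) ^ M * (b : ℝ) ^ L) * (1 - ((b : ℝ) ^ L)⁻¹)⁻¹ =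
        ((f : ℝ) - e) / ((b : ℝ) ^ M * ((b : ℝ) ^ L - 1)) := by
      have h1 : (b : ℝ) ^ L - 1 ≠ 0 := by linarith
      have h2 : 1 - ((b : ℝ) ^ L)⁻¹ = ((b : ℝ) ^ L - 1) / (b : ℝ) ^ L := by field_simp
      rw [h2]
      field_simp
    rw [hval] at h
    refine h.congr_fun fun t => ?_
    have h1 : g t + 1 = M + (t + 1) * L := by have := hLt t; simp only [hg]; lia
    rw [h1, pow_add, mul_comm (t + 1) L, pow_mul, pow_succ, inv_pow]
    field_simp
  have hdiff : HasSum (fun j => ((c' j : ℝ) - c j) / (b : ℝ) ^ (j + 1))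
      (((f : ℝ) - e) / ((b : ℝ) ^ M * ((b : ℝ) ^ L - 1))) := by
    rw [← hginj.hasSum_iff]
    · convert hgeom using 1
      funext t
      simp only [Function.comp, hg, hc, hc']
    · intro j hj
      rw [hcc' j fun t ht => hj ⟨t, ht.symm⟩]
      simp
  convert hx.add hdiff using 1
  funext j
  ring

/-- `c` with the digits in positions `M + (t + 1) * L - 1` replaced by `f`. -/
noncomputable def toggleDigits (L M f : ℕ) (c : ℕ → ℕ) (j : ℕ) : ℕ :=
  open Classical in if ∃ t, j = M + (t + 1) * L - 1 then f else c j

theorem toggleDigits_apply (L M f : ℕ) (c : ℕ → ℕ) (t : ℕ) :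
    toggleDigits L M f c (M + (t + 1) * L - 1) = f :=
  if_pos ⟨t, rfl⟩

theorem toggleDigits_mem {D : Finset ℕ} (L M : ℕ) {f : ℕ} {c : ℕ → ℕ} (hf : f ∈ D)
    (hc : ∀ j, c j ∈ D) (j : ℕ) : toggleDigits L M f c j ∈ D := by
  unfold toggleDigits
  split_ifs
  exacts [hf, hc j]

theorem hasSum_toggleDigits {b L M : ℕ} (hb : 2 ≤ b) (hL : 0 < L) {c : ℕ → ℕ} {e : ℕ} (f : ℕ)
    {x : ℝ} (hc : ∀ t, c (M + (t + 1) * L - 1) = e)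
    (hx : HasSum (fun j => (c j : ℝ) / (b : ℝ) ^ (j + 1)) x) :
    HasSum (fun j => (toggleDigits L M f c j : ℝ) / (b : ℝ) ^ (j + 1))
      (x + ((f : ℝ) - e) / ((b : ℝ) ^ M * ((b : ℝ) ^ L - 1))) :=
  hasSum_toggle_digits hb hL hc hx (toggleDigits_apply L M f c) fun _ hj =>
    if_neg fun ⟨t, ht⟩ => hj t ht

/-- The set of reals with a base `b` expansion using only digits from `D` is closed. -/
theorem isClosed_digitSet {b : ℕ} (hb : 2 ≤ b) (D : Finset ℕ) :
    IsClosed {x : ℝ | ∃ c : ℕ → ℕ, (∀ j, c j ∈ D) ∧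
      x = ∑' j : ℕ, (c j : ℝ) / (b : ℝ) ^ (j + 1)} := by
  have hcompact : IsCompact (Set.univ.pi fun _ : ℕ => (D : Set ℕ)) :=
    isCompact_univ_pi fun _ => D.finite_toSet.isCompact
  have hb1 : (1 : ℝ) < b := by exact_mod_cast hb
  have hcont : ContinuousOn (fun c : ℕ → ℕ => ∑' j : ℕ, (c j : ℝ) / (b : ℝ) ^ (j + 1))
      (Set.univ.pi fun _ : ℕ => (D : Set ℕ)) := by
    refine continuousOn_tsum (u := fun j => ((D.sup id : ℕ) : ℝ) * (1 / (b : ℝ)) ^ (j + 1))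
      (fun j => ?_) ?_ ?_
    · have : Continuous fun c : ℕ → ℕ => ((c j : ℕ) : ℝ) :=
        continuous_of_discreteTopology.comp (continuous_apply j)
      exact (this.div_const _).continuousOn
    · refine Summable.mul_left _ ((summable_nat_add_iff 1).2 ?_)
      exact summable_geometric_of_lt_one (by positivity) ((div_lt_one (by linarith)).2 hb1)
    · intro j c hc
      have h1 : c j ≤ D.sup id := Finset.le_sup (f := id) (hc j trivial)
      rw [Real.norm_of_nonneg (by positivity), one_div_pow, mul_one_div]
      gcongr
  convert (hcompact.image_of_continuousOn hcont).isClosed using 1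
  ext x
  constructor
  · rintro ⟨c, hc, rfl⟩
    exact ⟨c, fun j _ => hc j, rfl⟩
  · rintro ⟨c, hc, rfl⟩
    exact ⟨c, fun j => hc j trivial, rfl⟩

theorem exists_dvd_pow_mul_pow_sub_one (b : ℕ) {K : ℕ} (hK : 0 < K) :
    ∃ M T : ℕ, M ≤ T ∧ 0 < T ∧ (K : ℤ) ∣ (b : ℤ) ^ M * ((b : ℤ) ^ T - 1) := by
  have : NeZero K := ⟨hK.ne'⟩
  have key : ∃ m n : ℕ, m < n ∧ ((b : ZMod K)) ^ m = (b : ZMod K) ^ n := by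
    obtain ⟨m, n, hmn, h⟩ := Finite.exists_ne_map_eq_of_infinite fun n : ℕ => (b : ZMod K) ^ n
    rcases hmn.lt_or_gt with h' | h'
    exacts [⟨m, n, h', h⟩, ⟨n, m, h', h.symm⟩]
  obtain ⟨m, n, hmn, h⟩ := key
  obtain ⟨t, rfl⟩ := Nat.exists_eq_add_of_lt hmn
  refine ⟨m, (t + 1) * (m + 1), by nlinarith, by positivity, ?_⟩
  have h1 : (K : ℤ) ∣ (b : ℤ) ^ m * ((b : ℤ) ^ (t + 1) - 1) := by
    rw [← ZMod.intCast_zmod_eq_zero_iff_dvd]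
    push_cast
    rw [mul_sub, ← pow_add, ← add_assoc, ← h]
    ring
  refine h1.trans (mul_dvd_mul_left _ ?_)
  rw [pow_mul]
  exact sub_one_dvd_pow_sub_one _ _

theorem dvd_geom_sum_sub {x q : ℤ} (hq : q ∣ x * (x - 1)) (n : ℕ) :
    q ∣ (∑ i ∈ Finset.range (n + 1), x ^ i) - (1 + x * n) := by
  induction n with
  | zero => simp
  | succ n ih =>
    rw [Finset.sum_range_succ]
    have h1 : q ∣ x ^ (n + 1) - x := by
      have h2 : x ^ (n + 1) - x = x * (x ^ n - 1) := by ring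
      rw [h2]
      exact hq.trans (mul_dvd_mul_left _ (sub_one_dvd_pow_sub_one _ _))
    obtain ⟨u, hu⟩ := dvd_add ih h1
    refine ⟨u, ?_⟩
    rw [← hu]
    push_cast
    ring

theorem le_geom_sum {x : ℕ} (hx : 1 ≤ x) (n : ℕ) :
    n ≤ ∑ i ∈ Finset.range n, x ^ i := by
  calc n = ∑ i ∈ Finset.range n, 1 := by simp
    _ ≤ _ := Finset.sum_le_sum fun i _ => Nat.one_le_pow _ _ hx

theorem mul_position_eq (t L n : ℕ) :
    (t + 1) * (L * (n + 1)) = ((t + 1) * (n + 1) - 1 + 1) * L := by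
  rw [Nat.sub_add_cancel (Nat.mul_pos t.succ_pos n.succ_pos)]
  simp only [Nat.succ_eq_add_one]
  ring

/-- Two rationals `p / q` and `p' / q'` with `p' * q - p * q' = s = ±1`, the second with a base
`b` expansion `c` all of whose digits in positions `M + (t + 1) * L - 1` are equal to `e`, such
that switching these digits to `f` moves in the direction opposite to `s`. -/
structure CantorPair (b d M : ℕ) (D : Finset ℕ) where
  p : ℤ
  q : ℕ
  p' : ℤ
  q' : ℕ
  s : ℤ
  L : ℕ
  c : ℕ → ℕ
  e : ℕ
  f : ℕ
  q_pos : 0 < q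
  q'_pos : 0 < q'
  s_mul_self : s * s = 1
  det : p' * q - p * q' = s
  M_le : M ≤ L
  L_pos : 0 < L
  mul_eq : (d * q * q' : ℤ) = (b : ℤ) ^ M * ((b : ℤ) ^ L - 1)
  e_mem : e ∈ D
  f_mem : f ∈ D
  f_sub_e : (f - e : ℤ) = -s * d
  c_mem : ∀ j, c j ∈ D
  c_eq : ∀ t, c (M + (t + 1) * L - 1) = e
  hasSum : HasSum (fun j => (c j : ℝ) / (b : ℝ) ^ (j + 1)) (p' / q')

theorem CantorPair.exists_next {b d M : ℕ} {D : Finset ℕ} (hb : 2 ≤ b) (hd : 0 < d)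
    (S : CantorPair b d M D) (Z : ℕ) : ∃ S' : CantorPair b d M D,
      S'.p = S.p' ∧ S'.q = S.q' ∧ S'.s = -S.s ∧ Z ≤ S'.q' := by
  obtain ⟨p, q, p', q', s, L, c, e, f, hq, hq', hs, hdet, hML, hL, hmul, he, hf, hfe, hc, hce,
    hsum⟩ := S
  dsimp only
  set n := Z * q' with hn
  set R : ℕ := ∑ i ∈ Finset.range (n + 1), (b ^ L) ^ i with hR
  have hRZ : (R : ℤ) = ∑ i ∈ Finset.range (n + 1), ((b : ℤ) ^ L) ^ i := by rw [hR]; push_cast; rfl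
  have hnR : n + 1 ≤ R := le_geom_sum (Nat.one_le_pow _ _ (by lia)) _
  have hq'dvd : (q' : ℤ) ∣ (b : ℤ) ^ L * ((b : ℤ) ^ L - 1) :=
    (Dvd.intro_left _ hmul).trans (mul_dvd_mul_right (pow_dvd_pow _ hML) _)
  obtain ⟨A, hA⟩ : (q' : ℤ) ∣ R - 1 := by
    have h1 := dvd_geom_sum_sub hq'dvd n
    have h2 : (q' : ℤ) ∣ (b : ℤ) ^ L * n := ⟨(b : ℤ) ^ L * Z, by rw [hn]; push_cast; ring⟩
    rw [← hRZ] at h1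
    obtain ⟨u, hu⟩ := dvd_add h1 h2
    exact ⟨u, by linear_combination hu⟩
  have hmul' : (d * q' * (q * R : ℕ) : ℤ) = (b : ℤ) ^ M * ((b : ℤ) ^ (L * (n + 1)) - 1) := by
    have h1 := geom_sum_mul ((b : ℤ) ^ L) (n + 1)
    rw [← hRZ] at h1
    rw [pow_mul, ← h1]
    push_cast
    linear_combination (R : ℤ) * hmul
  have hdet' : (p + q * A * p') * q' - p' * (q * R : ℕ) = -s := by
    push_cast
    linear_combination -hdet - q * p' * hA
  have hce' : ∀ t, c (M + (t + 1) * (L * (n + 1)) - 1) = e := fun t => by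
    rw [mul_position_eq]
    exact hce _
  have hL' : 0 < L * (n + 1) := by positivity
  have hqR : 0 < q * R := Nat.mul_pos hq (by lia)
  refine ⟨⟨p', q', p + q * A * p', q * R, -s, L * (n + 1),
    toggleDigits (L * (n + 1)) M f c, f, e, hq', hqR, by linarith, hdet',
    hML.trans (Nat.le_mul_of_pos_right _ n.succ_pos), hL', hmul', hf, he, by linarith,
    toggleDigits_mem _ _ hf hc, toggleDigits_apply _ _ _ _, ?_⟩, rfl, rfl, rfl, ?_⟩
  · convert hasSum_toggleDigits hb hL' f hce' hsum using 1
    have h1 : (d * q' * (q * R : ℕ) : ℝ) = (b : ℝ) ^ M * ((b : ℝ) ^ (L * (n + 1)) - 1) := by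
      exact_mod_cast hmul'
    have h2 : ((p + q * A * p' : ℤ) * q' - p' * (q * R : ℕ) : ℝ) = -s := by exact_mod_cast hdet'
    have h3 : (f - e : ℝ) = -s * d := by exact_mod_cast hfe
    have hd' : (d : ℝ) ≠ 0 := by positivity
    have hq'' : (q' : ℝ) ≠ 0 := by positivity
    have hqR' : ((q * R : ℕ) : ℝ) ≠ 0 := by positivity
    rw [← h1, h3, ← h2]
    field_simp
    ring
  · dsimp only
    calc Z ≤ Z * q' := Nat.le_mul_of_pos_right _ hq'
      _ ≤ R := by lia
      _ ≤ q * R := Nat.le_mul_of_pos_left _ hq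

theorem hasSum_const_digits {b : ℕ} (hb : 2 ≤ b) (a : ℕ) :
    HasSum (fun j : ℕ => (a : ℝ) / (b : ℝ) ^ (j + 1)) (a / (b - 1)) := by
  have hb1 : (1 : ℝ) < b := by exact_mod_cast hb
  have h := (hasSum_geometric_of_lt_one (r := (b : ℝ)⁻¹) (by positivity)
    (inv_lt_one_of_one_lt₀ hb1)).mul_left ((a : ℝ) / b)
  have hval : (a : ℝ) / b * (1 - (b : ℝ)⁻¹)⁻¹ = a / (b - 1) := by
    have h1 : (b : ℝ) - 1 ≠ 0 := by linarith
    have h2 : 1 - (b : ℝ)⁻¹ = (b - 1) / b := by field_simp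
    rw [h2]
    field_simp
  rw [hval] at h
  refine h.congr_fun fun t => ?_
  rw [pow_succ, inv_pow]
  field_simp

theorem exists_cantorPair {b : ℕ} {D : Finset ℕ} (hb : 2 ≤ b) {a a' : ℕ} (haa' : a < a')
    (ha'b : a' < b) (ha : a ∈ D) (ha' : a' ∈ D) :
    ∃ M, Nonempty (CantorPair b (a' - a) M D) := by
  obtain ⟨d, hd, rfl⟩ : ∃ d, 0 < d ∧ a' = a + d := ⟨a' - a, by lia, by lia⟩
  rw [Nat.add_sub_cancel_left]
  obtain ⟨g, rfl⟩ : ∃ g, b = g + 1 := ⟨b - 1, by lia⟩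
  obtain ⟨M, T, hMT, hT, Y, hY⟩ := exists_dvd_pow_mul_pow_sub_one (g + 1) (K := d * g * g)
    (by have : 0 < g := by lia
        positivity)
  have hg : 0 < g := by lia
  have hYpos : 0 < Y := by
    have h1 : 1 < ((g + 1 : ℕ) : ℤ) ^ T := one_lt_pow₀ (by lia) hT.ne'
    have h2 : 0 < ((g + 1 : ℕ) : ℤ) ^ M * (((g + 1 : ℕ) : ℤ) ^ T - 1) := by
      apply mul_pos (by positivity); linarith
    rw [hY] at h2
    exact pos_of_mul_pos_right h2 (by positivity)
  lift Y to ℕ using hYpos.le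
  have hYpos' : 0 < Y := by exact_mod_cast hYpos
  set B : ℤ := ((g + 1 : ℕ) : ℤ) with hB
  set X : ℕ := g * Y with hX
  set n := (g - a) * X with hn
  set R : ℕ := ∑ i ∈ Finset.range (n + 1), ((g + 1) ^ T) ^ i with hR
  have hRZ : (R : ℤ) = ∑ i ∈ Finset.range (n + 1), (B ^ T) ^ i := by rw [hR]; push_cast; rfl
  have hRpos : 0 < R := (le_geom_sum (Nat.one_le_pow _ _ (by lia)) (n + 1)).trans_lt' (by lia)
  have hqdvd : ((g * X : ℕ) : ℤ) ∣ B ^ T * (B ^ T - 1) := by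
    refine Dvd.dvd.trans ?_ (mul_dvd_mul_right (pow_dvd_pow B hMT) _)
    exact ⟨d, by rw [hY, hX]; push_cast; ring⟩
  obtain ⟨P, hP⟩ : ((g * X : ℕ) : ℤ) ∣ (a * X + 1) * R - 1 := by
    obtain ⟨u, hu⟩ := dvd_geom_sum_sub hqdvd n
    obtain ⟨v, hv⟩ : (g : ℤ) ∣ B ^ T - 1 := by
      have := sub_one_dvd_pow_sub_one B T
      rwa [show B - 1 = g by simp [hB]] at this
    rw [← hRZ] at hu
    have hnZ : (n : ℤ) = (g - a) * X := by
      rw [hn, Nat.cast_mul, Nat.cast_sub (by lia)]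
    have hR' : (R : ℤ) = (g * X : ℕ) * u + (1 + (1 + g * v) * ((g - a) * X)) := by
      rw [← hv, ← hnZ]; linear_combination hu
    have hXX : (X : ℤ) = g * Y := by rw [hX]; push_cast; rfl
    refine ⟨(a * X + 1) * (u + 1 + v * (g - a)) - a ^ 2 * Y, ?_⟩
    rw [hR']
    push_cast
    linear_combination -(a : ℤ) ^ 2 * X * hXX
  have hb' : 2 ≤ g + 1 := hb
  have hL : 0 < T * (n + 1) := by positivity
  have hqpos : 0 < g * X := by positivity
  have hdet : P * (g * X : ℕ) - (a * X + 1) * R = -1 := by linear_combination -hP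
  have hmul : (d * (g * X : ℕ) * R : ℤ) = B ^ M * (B ^ (T * (n + 1)) - 1) := by
    have h1 := geom_sum_mul (B ^ T) (n + 1)
    rw [← hRZ] at h1
    rw [pow_mul, ← h1, mul_left_comm (B ^ M), hY, hX]
    push_cast
    ring
  have htog : ∀ t, toggleDigits T M (a + d) (fun _ => a) (M + (t + 1) * (T * (n + 1)) - 1) =
      a + d := fun t => by
    rw [mul_position_eq]
    exact toggleDigits_apply _ _ _ _ _
  refine ⟨M, ⟨⟨a * X + 1, g * X, P, R, -1, T * (n + 1),
    toggleDigits (T * (n + 1)) M a (toggleDigits T M (a + d) fun _ => a), a, a + d, hqpos, hRpos,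
    by norm_num, hdet, hMT.trans (Nat.le_mul_of_pos_right _ n.succ_pos), hL, hmul, ha, ha',
    by push_cast; ring, toggleDigits_mem _ _ ha (toggleDigits_mem _ _ ha' fun _ => ha),
    toggleDigits_apply _ _ _ _, ?_⟩⟩⟩
  convert hasSum_toggleDigits hb' hL a htog
    (hasSum_toggleDigits hb' hT (a + d) (fun _ => rfl) (hasSum_const_digits hb' a)) using 1
  have h1 : (d * (g * X : ℕ) * R : ℝ) =
      ((g + 1 : ℕ) : ℝ) ^ M * (((g + 1 : ℕ) : ℝ) ^ (T * (n + 1)) - 1) := by exact_mod_cast hmul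
  have h2 : (P * (g * X : ℕ) - (a * X + 1) * R : ℝ) = -1 := by exact_mod_cast hdet
  have h3 : ((g + 1 : ℕ) : ℝ) ^ M * (((g + 1 : ℕ) : ℝ) ^ T - 1) = d * g * X := by
    have : B ^ M * (B ^ T - 1) = d * g * X := by rw [hY, hX]; push_cast; ring
    exact_mod_cast this
  have hd' : (d : ℝ) ≠ 0 := by positivity
  have hg' : (g : ℝ) ≠ 0 := by positivity
  have hX' : (X : ℝ) ≠ 0 := by positivity
  have hR' : (R : ℝ) ≠ 0 := by positivity
  have hg1 : ((g + 1 : ℕ) : ℝ) - 1 = g := by push_cast; ring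
  rw [← h1, h3, hg1]
  push_cast at h2 ⊢
  field_simp
  linear_combination (d : ℝ) * h2

/-- Every `CantorPair` extends to a chain in which consecutive pairs share a rational and the
denominators grow as fast as prescribed. -/
theorem CantorPair.exists_seq {b d M : ℕ} {D : Finset ℕ} (hb : 2 ≤ b) (hd : 0 < d)
    (S₀ : CantorPair b d M D) (Z : ℕ → ℕ) : ∃ S : ℕ → CantorPair b d M D, S 0 = S₀ ∧
      ∀ k, (S (k + 1)).p = (S k).p' ∧ (S (k + 1)).q = (S k).q' ∧ (S (k + 1)).s = -(S k).s ∧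
        Z (S k).q' ≤ (S (k + 1)).q' := by
  choose next hnext using fun S : CantorPair b d M D => S.exists_next hb hd (Z S.q')
  exact ⟨fun k => next^[k] S₀, rfl, fun k => by
    simp only [Function.iterate_succ_apply']
    exact hnext _⟩

/-- let `b ≥ 3`, `D ⊆ {0,…,b−1}` with `|D| = 2`, and let `C` be the
missing-digit Cantor set `C = { Σ_{j≥1} c_j b^{-j} : c_j ∈ D }`. Then there is a
constant `Q` (depending only on `b` and `D`) such that for every `Ψ : ℕ → (0,1]`
there exists a Liouville number `ξ ∈ C` all of whose continued fraction
convergents `p/q` with `q ≥ Q` lie in `C` and satisfy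
`|ξ − p/q| < min (Ψ q) (q^{-q})`. -/
theorem stmt14 (b : ℕ) (hb : 3 ≤ b) (D : Finset ℕ) (hD : D ⊆ Finset.range b)
    (hDcard : D.card = 2)
    (C : Set ℝ)
    (hC : C = {x : ℝ | ∃ c : ℕ → ℕ, (∀ j, c j ∈ D) ∧
      x = ∑' j : ℕ, (c j : ℝ) / (b : ℝ) ^ (j + 1)}) :
    ∃ Q : ℕ, ∀ Ψ : ℕ → ℝ, (∀ n, Ψ n ∈ Set.Ioc (0 : ℝ) 1) →
      ∃ ξ ∈ C, Liouville ξ ∧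
        ∀ (n : ℕ) (q : ℕ), (GenContFract.of ξ).dens n = (q : ℝ) → Q ≤ q →
          (GenContFract.of ξ).convs n ∈ C ∧
          |ξ - (GenContFract.of ξ).convs n| < min (Ψ q) (((q : ℝ) ^ q)⁻¹) := by
  have hb2 : 2 ≤ b := by lia
  obtain ⟨a, a', haa', ha, ha'⟩ : ∃ a a', a < a' ∧ a ∈ D ∧ a' ∈ D := by
    obtain ⟨x, y, hxy, rfl⟩ := Finset.card_eq_two.1 hDcard
    rcases hxy.lt_or_gt with h | h
    exacts [⟨x, y, h, by simp, by simp⟩, ⟨y, x, h, by simp, by simp⟩]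
  obtain ⟨M, ⟨S₀⟩⟩ := exists_cantorPair hb2 haa' (Finset.mem_range.1 (hD ha')) ha ha'
  refine ⟨S₀.q' + 1, fun Ψ hΨ => ?_⟩
  have hZ : ∀ m : ℕ, ∃ Z : ℕ, 0 < m → (1 : ℝ) / (Z + 1) < min (Ψ m) (((m : ℝ) ^ m)⁻¹) := by
    intro m
    rcases m.eq_zero_or_pos with rfl | hm
    · exact ⟨0, fun h => absurd h (lt_irrefl _)⟩
    · obtain ⟨Z, hZ⟩ := exists_nat_one_div_lt
        (lt_min (hΨ m).1 (by positivity : (0 : ℝ) < ((m : ℝ) ^ m)⁻¹))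
      exact ⟨Z, fun _ => hZ⟩
  choose Z hZ using hZ
  obtain ⟨S, hS₀, hS⟩ := S₀.exists_seq hb2 (by lia) fun m => max (Z m + 1) (2 * m)
  choose hp hq hs hgrow using hS
  set p : ℕ → ℤ := fun k => (S k).p' with hpdef
  set q : ℕ → ℕ := fun k => (S k).q' with hqdef
  have hqpos : ∀ k, 0 < q k := fun k => (S k).q'_pos
  have hq2 : ∀ k, 2 * q k ≤ q (k + 1) := fun k => (le_max_right _ _).trans (hgrow k)
  have hdet : ∀ k, p (k + 1) * q k - p k * q (k + 1) = (S (k + 1)).s := fun k => by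
    simp only [hpdef, hqdef, ← (S (k + 1)).det, hp, hq]
  obtain ⟨ξ, hξ, hξk⟩ := exists_tendsto_of_alternating_det
    (fun k => (S (k + 1)).s_mul_self) (fun k => hs (k + 1)) (hqpos 0) hq2 hdet
  have hmem : ∀ k, (p k / q k : ℝ) ∈ C := fun k => by
    rw [hC]
    exact ⟨(S k).c, (S k).c_mem, (S k).hasSum.tsum_eq.symm⟩
  have hclose : ∀ k, |ξ - p k / q k| < min (Ψ (q k)) (((q k : ℝ) ^ q k)⁻¹) := fun k => by
    refine (hξk k).2.trans_le (le_trans ?_ (hZ (q k) (hqpos k)).le)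
    have h1 : ((Z (q k) : ℝ) + 1) ≤ q (k + 1) := by
      exact_mod_cast (le_max_left _ _).trans (hgrow k)
    have h2 : (1 : ℝ) ≤ q k := by exact_mod_cast hqpos k
    apply one_div_le_one_div_of_le (by positivity)
    nlinarith
  have hqmono : ∀ k, k < q k := fun k => by
    induction k with
    | zero => exact hqpos 0
    | succ k ih => have := hq2 k; lia
  have hliou : Liouville ξ := fun n => by
    refine ⟨p (n + 1), q (n + 1), ?_, ?_, ?_⟩
    · have := hqmono (n + 1)
      exact_mod_cast (by lia : 1 < q (n + 1))
    · exact_mod_cast (hξk (n + 1)).1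
    · have h1 : (1 : ℝ) ≤ q (n + 1) := by exact_mod_cast hqpos (n + 1)
      have h2 := (hclose (n + 1)).trans_le (min_le_right _ _)
      push_cast
      refine h2.trans_le ?_
      rw [one_div]
      apply inv_anti₀ (by positivity)
      exact pow_le_pow_right₀ h1 (by have := hqmono (n + 1); lia)
  refine ⟨ξ, ?_, hliou, fun n m hm hQ => ?_⟩
  · subst hC
    exact (isClosed_digitSet hb2 D).mem_of_tendsto hξ (Eventually.of_forall hmem)
  · obtain ⟨i, hi⟩ := exists_convs_eq_of_det hliou.irrational
      (fun k => (S (k + 1)).s_mul_self) (hqpos 0) hq2 hdet fun k => (hξk k).2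
    have hin : i ≤ n := by
      by_contra! hlt
      have h1 := monotone_nat_of_le_succ
        (fun k => GenContFract.of_den_mono (v := ξ) (n := k)) hlt.le
      have h2 : (GenContFract.of ξ).dens i = q 0 := (hi 0).2
      rw [hm, h2] at h1
      have h3 : m ≤ q 0 := by exact_mod_cast h1
      have h4 : q 0 = S₀.q' := by rw [← hS₀]
      lia
    obtain ⟨k, rfl⟩ := Nat.exists_eq_add_of_le hin
    obtain ⟨hconv, hden⟩ := hi k
    obtain rfl : m = q k := by rw [hm] at hden; exact_mod_cast hden
    rw [hconv]
    exact ⟨hmem k, hclose k⟩
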